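/- Let n ≥ 3, V ∈ RH_q with q > n/2, with critical radius function ρ. Let p : (0,∞) × ℝⁿ × ℝⁿ → [0,∞) be measurable and suppose that for every N > 0 there exist constants C, c > 0 such that p_t(x,y) ≤ C t^{−n/2} exp(−c|x−y|²/t) (1 + √t/ρ(x) + √t/ρ(y))^{−N} for all t > 0 and x, y ∈ ℝⁿ. Let 0 < α < n and define K_α(x,y) = ∫₀^∞ t^{α/2} p_t(x,y) dt/t. Then for every N > 0 there exists a constant C such that |K_α(x,y)| ≤ C (1 + |x−y|/ρ(x))^{−N} |x−y|^{α−n} for all x ≠ y. -/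

import Mathlib

open MeasureTheory Metric Set
open scoped ENNReal

noncomputable section

/-- Euclidean space `ℝⁿ`. -/
abbrev Eucl (n : ℕ) := EuclideanSpace ℝ (Fin n)

namespace SchrodingerCommutators

variable {n : ℕ}

/-- The average `(1/|B(x,r)|) ∫_{B(x,r)} f` of a function over a ball. -/
def ballAvg (f : Eucl n → ℝ) (x : Eucl n) (r : ℝ) : ℝ :=
  (volume (ball x r)).toReal⁻¹ * ∫ y in ball x r, f y

/-- `V` is a nonnegative locally integrable function in the reverse Hölder class `RH_q`:
`((1/|B|)∫_B V^q)^{1/q} ≤ (C/|B|) ∫_B V` for all balls `B`. -/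
def IsRH (V : Eucl n → ℝ) (q : ℝ) : Prop :=
  (∀ x, 0 ≤ V x) ∧ LocallyIntegrable V volume ∧
    ∃ C > 0, ∀ (x : Eucl n) (r : ℝ), 0 < r →
      (ballAvg (fun y => V y ^ q) x r) ^ (1 / q) ≤ C * ballAvg V x r

/-- The critical radius function `ρ(x) = sup {r > 0 : r^{2-n} ∫_{B(x,r)} V ≤ 1}`. -/
def critRad (V : Eucl n → ℝ) (x : Eucl n) : ℝ :=
  sSup {r : ℝ | 0 < r ∧ r ^ (2 - (n : ℝ)) * ∫ y in ball x r, V y ≤ 1}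

/-- The `A_p^{L,θ}` condition for a weight `w`, relative to a critical radius function `ρ`:
`(∫_B w)^{1/p} (∫_B w^{-1/(p-1)})^{1/p'} ≤ C |B| (1 + r/ρ(x))^θ` for all balls `B = B(x,r)`. -/
def MemApLtheta (ρ : Eucl n → ℝ) (w : Eucl n → ℝ) (p θ : ℝ) : Prop :=
  ∃ C > 0, ∀ (x : Eucl n) (r : ℝ), 0 < r →
    (∫ y in ball x r, w y) ^ (1 / p) *
        (∫ y in ball x r, w y ^ (-(1 / (p - 1)))) ^ (1 - 1 / p)
      ≤ C * (volume (ball x r)).toReal * (1 + r / ρ x) ^ θ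

/-- `w ∈ A_p^L = ∪_{θ>0} A_p^{L,θ}`. -/
def MemApL (ρ : Eucl n → ℝ) (w : Eucl n → ℝ) (p : ℝ) : Prop :=
  ∃ θ > 0, MemApLtheta ρ w p θ

/-- The conjugate exponent `r' = r/(r-1)`. -/
def conjExp (r : ℝ) : ℝ := r / (r - 1)

/-- `b` satisfies the `BMO_L^θ` bound with constant `C`:
`(1/|B|) ∫_B |b - b_B| ≤ C (1 + r/ρ(x))^θ` for all balls `B = B(x,r)`. -/
def BMOLBound (ρ : Eucl n → ℝ) (b : Eucl n → ℝ) (θ C : ℝ) : Prop :=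
  ∀ (x : Eucl n) (r : ℝ), 0 < r →
    (volume (ball x r)).toReal⁻¹ * (∫ y in ball x r, |b y - ballAvg b x r|)
      ≤ C * (1 + r / ρ x) ^ θ

/-- `b ∈ BMO_L^θ`: `b` is locally integrable and satisfies the `BMO_L^θ` bound
for some finite constant. -/
def MemBMOL (ρ : Eucl n → ℝ) (b : Eucl n → ℝ) (θ : ℝ) : Prop :=
  LocallyIntegrable b volume ∧ ∃ C ≥ 0, BMOLBound ρ b θ C

/-- `‖b‖_θ`: the least constant in the `BMO_L^θ` bound. -/
def bmoLNorm (ρ : Eucl n → ℝ) (b : Eucl n → ℝ) (θ : ℝ) : ℝ :=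
  sInf {C : ℝ | 0 ≤ C ∧ BMOLBound ρ b θ C}

/-- The local maximal function `M_{ρ,α} g(x) = sup_{x ∈ B(y,r), r ≤ αρ(y)} (1/|B|)∫_B |g|`. -/
def MrhoLoc (ρ : Eucl n → ℝ) (α : ℝ) (g : Eucl n → ℝ) (x : Eucl n) : ℝ :=
  sSup {m : ℝ | ∃ (y : Eucl n) (r : ℝ), 0 < r ∧ r ≤ α * ρ y ∧ x ∈ ball y r ∧
    m = ballAvg (fun z => |g z|) y r}

/-- The local sharp maximal function
`M^♯_{ρ,α} g(x) = sup_{x ∈ B(y,r), r ≤ αρ(y)} (1/|B|)∫_B |g - g_B|`. -/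
def MrhoSharp (ρ : Eucl n → ℝ) (α : ℝ) (g : Eucl n → ℝ) (x : Eucl n) : ℝ :=
  sSup {m : ℝ | ∃ (y : Eucl n) (r : ℝ), 0 < r ∧ r ≤ α * ρ y ∧ x ∈ ball y r ∧
    m = ballAvg (fun z => |g z - ballAvg g y r|) y r}

/-- A covering family of critical balls `Q_j = B(x_j, ρ(x_j))`: the balls cover `ℝⁿ`
and the dilates `σQ_j` have finite overlap `Σ_j χ_{σQ_j} ≤ C σ^{N₁}` for every `σ ≥ 1`. -/
def IsCriticalCovering (V : Eucl n → ℝ) (c : ℕ → Eucl n) : Prop :=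
  (⋃ k, ball (c k) (critRad V (c k))) = univ ∧
    ∀ σ : ℝ, 1 ≤ σ → ∃ C > 0, ∃ N₁ : ℝ, ∀ x : Eucl n,
      (∑' k : ℕ, (ball (c k) (σ * critRad V (c k))).indicator (fun _ => (1 : ℝ≥0∞)) x)
        ≤ ENNReal.ofReal (C * σ ^ N₁)

/-- The operator `G_{κ,α,s}` (with decay parameter `N`):
`G f(x) = sup_{Q ∋ x critical} Σ_k 2^{-Nk} (|2^k κQ|^{αs/n - 1} ∫_{2^k κQ} |f|^s)^{1/s}`. -/
def Gop (V : Eucl n → ℝ) (κ α s N : ℝ) (f : Eucl n → ℝ) (x : Eucl n) : ℝ :=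
  sSup {m : ℝ | ∃ y : Eucl n, x ∈ ball y (critRad V y) ∧
    m = ∑' k : ℕ, (2 : ℝ) ^ (-(N * (k : ℝ))) *
      ((volume (ball y (2 ^ k * κ * critRad V y))).toReal ^ (α * s / (n : ℝ) - 1) *
        ∫ z in ball y (2 ^ k * κ * critRad V y), |f z| ^ s) ^ (1 / s)}

/-- The operator `H_{κ,s}` (with decay parameter `N`):
`H f(x) = sup_{Q ∋ x critical} Σ_k 2^{-Nk} (|2^k κQ|⁻¹ ∫_{2^k κQ} |f|^s)^{1/s}`. -/
def Hop (V : Eucl n → ℝ) (κ s N : ℝ) (f : Eucl n → ℝ) (x : Eucl n) : ℝ :=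
  sSup {m : ℝ | ∃ y : Eucl n, x ∈ ball y (critRad V y) ∧
    m = ∑' k : ℕ, (2 : ℝ) ^ (-(N * (k : ℝ))) *
      ((volume (ball y (2 ^ k * κ * critRad V y))).toReal⁻¹ *
        ∫ z in ball y (2 ^ k * κ * critRad V y), |f z| ^ s) ^ (1 / s)}

/-- The fractional maximal function
`M_{α,s} f(x) = sup_{B ∋ x} (|B|^{sα/n - 1} ∫_B |f|^s)^{1/s}`. -/
def Mfrac (α s : ℝ) (f : Eucl n → ℝ) (x : Eucl n) : ℝ :=
  sSup {m : ℝ | ∃ (y : Eucl n) (r : ℝ), 0 < r ∧ x ∈ ball y r ∧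
    m = ((volume (ball y r)).toReal ^ (s * α / (n : ℝ) - 1) *
      ∫ z in ball y r, |f z| ^ s) ^ (1 / s)}

/-- The localized fractional maximal operator
`M̃_{α,s} f = Σ_k χ_{Q_k} M_{α,s}(f χ_{κ'Q_k})` attached to a covering family of
critical balls `Q_k = B(c_k, ρ(c_k))` with dilates `κ'Q_k`. -/
def Mtilde (V : Eucl n → ℝ) (c : ℕ → Eucl n) (κ' α s : ℝ) (f : Eucl n → ℝ)
    (x : Eucl n) : ℝ :=
  ∑' k : ℕ, (ball (c k) (critRad V (c k))).indicator
    (fun x' => Mfrac α s ((ball (c k) (κ' * critRad V (c k))).indicator f) x') x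

/-- The weighted measure `w dx`. -/
def wMeasure (w : Eucl n → ℝ) : Measure (Eucl n) :=
  volume.withDensity fun x => ENNReal.ofReal (w x)

end SchrodingerCommutators
open SchrodingerCommutators

/-- The inverse-gamma integral `∫₀^∞ t^{-a-1} e^{-b/t} dt = b^{-a} Γ(a)`. -/
theorem integral_rpow_mul_exp_neg_div_Ioi {a b : ℝ} (ha : 0 < a) (hb : 0 < b) :
    ∫ t in Ioi (0 : ℝ), t ^ (-a - 1) * Real.exp (-(b / t)) = b ^ (-a) * Real.Gamma a := by
  have h := integral_comp_rpow_Ioi (fun u : ℝ => u ^ (a - 1) * Real.exp (-(b * u)))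
    (show (-1 : ℝ) ≠ 0 by norm_num)
  rw [Real.integral_rpow_mul_exp_neg_mul_Ioi ha hb, one_div, Real.inv_rpow hb.le,
    ← Real.rpow_neg hb.le] at h
  rw [← h]
  refine setIntegral_congr_fun measurableSet_Ioi fun t ht => ?_
  have ht : 0 < t := ht
  simp only [abs_neg, abs_one, one_mul, smul_eq_mul]
  rw [← Real.rpow_mul ht.le, ← mul_assoc, ← Real.rpow_add ht, Real.rpow_neg_one, div_eq_mul_inv]
  ring_nf

theorem integrableOn_rpow_mul_exp_neg_div_Ioi {a b : ℝ} (ha : 0 < a) (hb : 0 < b) :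
    IntegrableOn (fun t : ℝ => t ^ (-a - 1) * Real.exp (-(b / t))) (Ioi 0) := by
  by_contra h
  have h0 := integral_undef h
  rw [integral_rpow_mul_exp_neg_div_Ioi ha hb] at h0
  exact (mul_pos (Real.rpow_pos_of_pos hb _) (Real.Gamma_pos_of_pos ha)).ne' h0

/-- Powers of `1 + u` are dominated by the Gaussian `e^{δu²}`. -/
theorem exists_one_add_rpow_le_exp {N δ : ℝ} (hN : 0 < N) (hδ : 0 < δ) :
    ∃ M > 0, ∀ u : ℝ, 0 ≤ u → (1 + u) ^ N ≤ M * Real.exp (δ * u ^ 2) := by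
  have hε : 0 < δ / N := div_pos hδ hN
  refine ⟨(2 + 1 / (δ / N)) ^ N, by positivity, fun u hu => ?_⟩
  have hbase : 1 + u ≤ (2 + 1 / (δ / N)) * Real.exp (δ / N * u ^ 2) := by
    calc 1 + u ≤ 2 + u ^ 2 := by nlinarith [sq_nonneg (u - 1)]
      _ ≤ (2 + 1 / (δ / N)) * (δ / N * u ^ 2 + 1) := by
        have : 1 / (δ / N) * (δ / N) = 1 := by field_simp
        have : 0 ≤ δ / N * u ^ 2 := by positivity
        have : 0 < 1 / (δ / N) := by positivity
        nlinarith
      _ ≤ _ := by gcongr; exact Real.add_one_le_exp _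
  calc (1 + u) ^ N ≤ ((2 + 1 / (δ / N)) * Real.exp (δ / N * u ^ 2)) ^ N := by gcongr
    _ = _ := by
      rw [Real.mul_rpow (by positivity) (by positivity), ← Real.exp_mul]
      congr 2
      field_simp

/-- Decay in `√t/ρ` is traded for decay in `d/ρ` at the cost of a power of `1 + d/√t`. -/
theorem one_add_mul_rpow_neg_le {s d r N : ℝ} (hs : 0 < s) (hd : 0 ≤ d) (hr : 0 ≤ r)
    (hN : 0 ≤ N) :
    (1 + s * r) ^ (-N) ≤ (1 + d * r) ^ (-N) * (1 + d / s) ^ N := by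
  have hle : 1 + d * r ≤ (1 + s * r) * (1 + d / s) := by
    have h : (1 + s * r) * (1 + d / s) = 1 + d * r + s * r + d / s := by field_simp; ring
    rw [h]
    have : 0 ≤ s * r + d / s := by positivity
    linarith
  have hpow : (1 + d * r) ^ N ≤ (1 + s * r) ^ N * (1 + d / s) ^ N := by
    rw [← Real.mul_rpow (by positivity) (by positivity)]
    gcongr
  rw [Real.rpow_neg (by positivity), Real.rpow_neg (by positivity), inv_mul_eq_div,
    inv_eq_one_div, div_le_div_iff₀ (by positivity) (by positivity)]
  linarith

theorem critRad_nonneg {n : ℕ} (V : Eucl n → ℝ) (x : Eucl n) : 0 ≤ critRad V x :=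
  Real.sSup_nonneg fun _ hr => hr.1.le

/-- Size estimate for the kernel `K_α(x,y) = ∫₀^∞ t^{α/2} p_t(x,y) dt/t`
of the fractional integral, from the Gaussian upper bound for the heat kernel:
`|K_α(x,y)| ≤ C (1+|x-y|/ρ(x))^{-N} |x-y|^{α-n}`. -/
theorem fractional_kernel_size {n : ℕ} (hn : 3 ≤ n) (V : Eucl n → ℝ)
    (q : ℝ) (hq : (n : ℝ) / 2 < q) (hV : IsRH V q)
    (p : ℝ → Eucl n → Eucl n → ℝ)
    (hmeas : Measurable fun t : ℝ × Eucl n × Eucl n => p t.1 t.2.1 t.2.2)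
    (hpos : ∀ t x y, 0 ≤ p t x y)
    (hgauss : ∀ N : ℝ, 0 < N → ∃ C > (0 : ℝ), ∃ c > (0 : ℝ), ∀ t : ℝ, 0 < t →
      ∀ x y : Eucl n,
        p t x y ≤ C * t ^ (-(n : ℝ) / 2) * Real.exp (-c * dist x y ^ 2 / t) *
          (1 + Real.sqrt t / critRad V x + Real.sqrt t / critRad V y) ^ (-N))
    (α : ℝ) (hα : 0 < α) (hαn : α < n)
    (K : Eucl n → Eucl n → ℝ)
    (hK : ∀ x y, K x y = ∫ t in Set.Ioi (0 : ℝ), t ^ (α / 2 - 1) * p t x y) :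
    ∀ N : ℝ, 0 < N → ∃ C > (0 : ℝ), ∀ x y : Eucl n, x ≠ y →
      |K x y| ≤ C * (1 + dist x y / critRad V x) ^ (-N) * dist x y ^ (α - (n : ℝ)) := by
  intro N hN
  obtain ⟨C, hC, c, hc, hp⟩ := hgauss N hN
  obtain ⟨M, hM, hMb⟩ := exists_one_add_rpow_le_exp hN (half_pos hc)
  set a : ℝ := ((n : ℝ) - α) / 2 with ha_def
  have ha : 0 < a := by rw [ha_def]; linarith
  have hΓ := Real.Gamma_pos_of_pos ha
  refine ⟨C * M * ((c / 2) ^ (-a) * Real.Gamma a), by positivity, fun x y hxy => ?_⟩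
  have hd : 0 < dist x y := dist_pos.mpr hxy
  set d := dist x y with hd_def
  have hρx := critRad_nonneg V x
  have hρy := critRad_nonneg V y
  set D := (1 + d / critRad V x) ^ (-N) with hD_def
  have hD : 0 ≤ D := by positivity
  have hb : 0 < c / 2 * d ^ 2 := by positivity
  have hpt : ∀ t ∈ Ioi (0 : ℝ), t ^ (α / 2 - 1) * p t x y ≤
      C * M * D * (t ^ (-a - 1) * Real.exp (-(c / 2 * d ^ 2 / t))) := by
    intro t ht
    have ht : 0 < t := ht
    have hs : 0 < √t := Real.sqrt_pos.mpr ht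
    have hdecay : (1 + √t / critRad V x + √t / critRad V y) ^ (-N) ≤
        D * (M * Real.exp (c / 2 * (d ^ 2 / t))) := by
      calc (1 + √t / critRad V x + √t / critRad V y) ^ (-N)
          ≤ (1 + √t * (critRad V x)⁻¹) ^ (-N) := by
            rw [← div_eq_mul_inv]
            refine Real.rpow_le_rpow_of_nonpos (by positivity) ?_ (by linarith)
            have : 0 ≤ √t / critRad V y := by positivity
            linarith
        _ ≤ D * (1 + d / √t) ^ N := by
            rw [hD_def, div_eq_mul_inv d (critRad V x)]
            exact one_add_mul_rpow_neg_le hs hd.le (by positivity) hN.le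
        _ ≤ D * (M * Real.exp (c / 2 * (d ^ 2 / t))) := by
            have h := hMb (d / √t) (by positivity)
            rw [div_pow, Real.sq_sqrt ht.le] at h
            gcongr
    calc t ^ (α / 2 - 1) * p t x y
        ≤ t ^ (α / 2 - 1) * (C * t ^ (-(n : ℝ) / 2) * Real.exp (-c * d ^ 2 / t) *
            (D * (M * Real.exp (c / 2 * (d ^ 2 / t))))) := by
          gcongr
          refine (hp t ht x y).trans ?_
          gcongr
      _ = C * M * D * ((t ^ (α / 2 - 1) * t ^ (-(n : ℝ) / 2)) *
            (Real.exp (-c * d ^ 2 / t) * Real.exp (c / 2 * (d ^ 2 / t)))) := by ring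
      _ = _ := by
          rw [← Real.rpow_add ht, ← Real.exp_add, ha_def]
          congr 3 <;> ring_nf
  have hnn : ∀ t ∈ Ioi (0 : ℝ), 0 ≤ t ^ (α / 2 - 1) * p t x y := fun t ht =>
    mul_nonneg (Real.rpow_nonneg (le_of_lt ht) _) (hpos t x y)
  rw [hK, abs_of_nonneg (setIntegral_nonneg measurableSet_Ioi hnn)]
  calc ∫ t in Ioi (0 : ℝ), t ^ (α / 2 - 1) * p t x y
      ≤ ∫ t in Ioi (0 : ℝ), C * M * D * (t ^ (-a - 1) * Real.exp (-(c / 2 * d ^ 2 / t))) :=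
        integral_mono_of_nonneg (ae_restrict_of_forall_mem measurableSet_Ioi hnn)
          ((integrableOn_rpow_mul_exp_neg_div_Ioi ha hb).const_mul _)
          (ae_restrict_of_forall_mem measurableSet_Ioi hpt)
    _ = C * M * ((c / 2) ^ (-a) * Real.Gamma a) * D * d ^ (α - (n : ℝ)) := by
        have hpow : (d ^ 2) ^ (-a) = d ^ (α - (n : ℝ)) := by
          rw [← Real.rpow_natCast, ← Real.rpow_mul hd.le, ha_def]
          congr 1
          push_cast
          ring
        rw [integral_const_mul, integral_rpow_mul_exp_neg_div_Ioi ha hb,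
          Real.mul_rpow (by positivity) (by positivity), hpow]
        ring
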